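/- Let R be a commutative noetherian ring, let a and b be ideals of R, let X be an R-module, and let s, t be non-negative integers such that: (a) H^{s+t-i}_a(H^i_b(X)) = 0 for all i in {0, ..., s+t} with i ≠ t; (b) H^{s+t-i+1}_a(H^i_b(X)) = 0 for all i in {0, ..., t-1}; and (c) H^{s+t-i-1}_a(H^i_b(X)) = 0 for all i in {t+1, ..., s+t}. Then H^s_a(H^t_b(X)) ≅ H^{s+t}_{a+b}(X). -/

import Mathlib

section

open CategoryTheory Limits

namespace LC

section Core

universe v₁ u₁ v₂ u₂
variable {A : Type u₁} [Category.{v₁} A] [Abelian A] {B : Type u₂} [Category.{v₂} B] [Abelian B]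

/-- A cohomological delta-functor (connecting maps only asserted to exist). -/
structure DeltaFunctor (T : ℕ → A ⥤ B) : Prop where
  mono₀ : ∀ S : ShortComplex A, S.ShortExact → Mono ((T 0).map S.f)
  ex₂ : ∀ S : ShortComplex A, S.ShortExact → ∀ p, ∃ w,
    (ShortComplex.mk ((T p).map S.f) ((T p).map S.g) w).Exact
  exδ : ∀ S : ShortComplex A, S.ShortExact → ∀ p,
    ∃ (δ : (T p).obj S.X₃ ⟶ (T (p+1)).obj S.X₁)
      (w₁ : (T p).map S.g ≫ δ = 0) (w₂ : δ ≫ (T (p+1)).map S.f = 0),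
      (ShortComplex.mk _ _ w₁).Exact ∧ (ShortComplex.mk _ _ w₂).Exact

variable {T : ℕ → A ⥤ B} (hT : DeltaFunctor T)
include hT

namespace DeltaFunctor

lemma isZero_of_isZero {X : A} (hX : IsZero X) (p : ℕ) : IsZero ((T p).obj X) := by
  let S : ShortComplex A := ShortComplex.mk (𝟙 X) (𝟙 X) (hX.eq_of_src _ _)
  have hS : S.ShortExact :=
    { exact := ShortComplex.exact_of_isZero_X₂ _ hX
      mono_f := by dsimp [S]; infer_instance
      epi_g := by dsimp [S]; infer_instance }
  obtain ⟨w, -⟩ := hT.ex₂ S hS p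
  rw [IsZero.iff_id_eq_zero]
  simpa [S] using w

lemma isZero₂ {S : ShortComplex A} (hS : S.ShortExact) {p : ℕ}
    (h₁ : IsZero ((T p).obj S.X₁)) (h₃ : IsZero ((T p).obj S.X₃)) :
    IsZero ((T p).obj S.X₂) := by
  obtain ⟨w, h⟩ := hT.ex₂ S hS p
  exact h.isZero_X₂ (h₁.eq_of_src _ _) (h₃.eq_of_tgt _ _)

lemma epi_g {S : ShortComplex A} (hS : S.ShortExact) {p : ℕ}
    (h₁ : IsZero ((T (p+1)).obj S.X₁)) : Epi ((T p).map S.g) := by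
  obtain ⟨δ, w₁, w₂, e₁, e₂⟩ := hT.exδ S hS p
  exact e₁.epi_f (h₁.eq_of_tgt _ _)

lemma mono_g {S : ShortComplex A} (hS : S.ShortExact) {p : ℕ}
    (h₁ : IsZero ((T p).obj S.X₁)) : Mono ((T p).map S.g) := by
  obtain ⟨w, h⟩ := hT.ex₂ S hS p
  exact h.mono_g (h₁.eq_of_src _ _)

lemma epi_f {S : ShortComplex A} (hS : S.ShortExact) {p : ℕ}
    (h₃ : IsZero ((T p).obj S.X₃)) : Epi ((T p).map S.f) := by
  obtain ⟨w, h⟩ := hT.ex₂ S hS p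
  exact h.epi_f (h₃.eq_of_tgt _ _)

lemma mono_f {S : ShortComplex A} (hS : S.ShortExact) {p : ℕ}
    (h₃ : IsZero ((T p).obj S.X₃)) : Mono ((T (p+1)).map S.f) := by
  obtain ⟨δ, w₁, w₂, e₁, e₂⟩ := hT.exδ S hS p
  exact e₂.mono_g (h₃.eq_of_src _ _)

lemma iso_g {S : ShortComplex A} (hS : S.ShortExact) {p : ℕ}
    (h : IsZero ((T p).obj S.X₁)) (h' : IsZero ((T (p+1)).obj S.X₁)) :
    Nonempty ((T p).obj S.X₂ ≅ (T p).obj S.X₃) := by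
  have := hT.epi_g hS h'
  have := hT.mono_g hS h
  have := isIso_of_mono_of_epi ((T p).map S.g)
  exact ⟨asIso ((T p).map S.g)⟩

lemma iso_f {S : ShortComplex A} (hS : S.ShortExact) {p : ℕ}
    (h : IsZero ((T p).obj S.X₃)) (h' : IsZero ((T (p+1)).obj S.X₃)) :
    Nonempty ((T (p+1)).obj S.X₁ ≅ (T (p+1)).obj S.X₂) := by
  have := hT.epi_f hS h'
  have := hT.mono_f hS h
  have := isIso_of_mono_of_epi ((T (p+1)).map S.f)
  exact ⟨asIso ((T (p+1)).map S.f)⟩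

lemma iso_δ {S : ShortComplex A} (hS : S.ShortExact) {p : ℕ}
    (h : IsZero ((T p).obj S.X₂)) (h' : IsZero ((T (p+1)).obj S.X₂)) :
    Nonempty ((T p).obj S.X₃ ≅ (T (p+1)).obj S.X₁) := by
  obtain ⟨δ, w₁, w₂, e₁, e₂⟩ := hT.exδ S hS p
  have : Epi δ := e₂.epi_f (h'.eq_of_tgt _ _)
  have : Mono δ := e₁.mono_g (h.eq_of_src _ _)
  have := isIso_of_mono_of_epi δ
  exact ⟨asIso δ⟩

lemma iso_coker {S : ShortComplex A} (hS : S.ShortExact)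
    (h : IsZero ((T 1).obj S.X₂)) :
    Nonempty (cokernel ((T 0).map S.g) ≅ (T 1).obj S.X₁) := by
  obtain ⟨δ, w₁, w₂, e₁, e₂⟩ := hT.exδ S hS 0
  have : Epi δ := e₂.epi_f (h.eq_of_tgt _ _)
  exact ⟨IsColimit.coconePointUniqueUpToIso (cokernelIsCokernel _) e₁.gIsCokernel⟩

lemma preservesFiniteLimits [(T 0).Additive] : PreservesFiniteLimits (T 0) := by
  refine ((Functor.preservesFiniteLimits_tfae (T 0)).out 0 3).1 fun S hS => ?_
  obtain ⟨w, h⟩ := hT.ex₂ S hS 0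
  exact ⟨h, hT.mono₀ S hS⟩

end DeltaFunctor

omit hT

section Complex

variable (K : CochainComplex A ℕ)

/-- boundaries -/
noncomputable abbrev bd (n : ℕ) : A := kernel (K.homologyπ n)

/-- `0 → B → Z → H → 0` -/
noncomputable abbrev sesH (n : ℕ) : ShortComplex A :=
  ShortComplex.mk (kernel.ι (K.homologyπ n)) (K.homologyπ n) (kernel.condition _)

lemma sesH_exact (n : ℕ) : (sesH K n).ShortExact where
  exact := ShortComplex.exact_kernel _
  mono_f := by dsimp [sesH]; infer_instance
  epi_g := by dsimp [sesH]; infer_instance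

noncomputable abbrev toBd (n : ℕ) : K.X n ⟶ bd K (n+1) :=
  kernel.lift _ (K.toCycles n (n+1)) (by simp)

lemma toBd_ι (n : ℕ) : toBd K n ≫ kernel.ι (K.homologyπ (n+1)) = K.toCycles n (n+1) := by
  simp [toBd]

/-- `0 → Z → C → B → 0` -/
noncomputable abbrev sesZ (n : ℕ) : ShortComplex A :=
  ShortComplex.mk (K.iCycles n) (toBd K n) (by
    rw [← cancel_mono (kernel.ι (K.homologyπ (n+1))), Category.assoc, toBd_ι]
    rw [← cancel_mono (K.iCycles (n+1))]
    simp)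

lemma sesZ_exact (n : ℕ) : (sesZ K n).ShortExact where
  exact := by
    have h := ShortComplex.exact_of_f_is_kernel
      (ShortComplex.mk (K.iCycles n) (K.d n (n+1)) (by simp)) (K.cyclesIsKernel n (n+1) (by simp))
    rw [ShortComplex.exact_iff_exact_up_to_refinements] at h ⊢
    intro X x hx
    refine h x ?_
    change X ⟶ K.X n at x
    change x ≫ toBd K n = 0 at hx
    change x ≫ K.d n (n+1) = 0
    have e : K.d n (n+1) = (toBd K n ≫ kernel.ι (K.homologyπ (n+1))) ≫ K.iCycles (n+1) := by
      rw [toBd_ι, K.toCycles_i]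
    rw [e, ← Category.assoc, ← Category.assoc, hx]
    simp
  mono_f := by dsimp [sesZ]; infer_instance
  epi_g := by
    have h := ShortComplex.exact_of_g_is_cokernel
      (ShortComplex.mk (K.toCycles n (n+1)) (K.homologyπ (n+1)) (by simp))
        (K.homologyIsCokernel n (n+1) (by simp))
    exact h.epi_kernelLift

lemma isZero_bd_zero : IsZero (bd K 0) :=
  isZero_kernel_of_mono _

/-- homology after applying a left exact functor. -/
noncomputable def cyclesMapIso (F : A ⥤ B) [F.Additive] [PreservesFiniteLimits F] (n : ℕ) :
    F.obj (K.cycles n) ≅ ((F.mapHomologicalComplex _).obj K).cycles n :=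
  IsLimit.conePointUniqueUpToIso
    (KernelFork.mapIsLimit _ (K.cyclesIsKernel n (n+1) (by simp)) F)
    (((F.mapHomologicalComplex _).obj K).cyclesIsKernel n (n+1) (by simp))

lemma cyclesMapIso_i (F : A ⥤ B) [F.Additive] [PreservesFiniteLimits F] (n : ℕ) :
    (cyclesMapIso K F n).hom ≫ ((F.mapHomologicalComplex _).obj K).iCycles n =
      F.map (K.iCycles n) := 
  IsLimit.conePointUniqueUpToIso_hom_comp
    (KernelFork.mapIsLimit _ (K.cyclesIsKernel n (n+1) (by simp)) F)
    (((F.mapHomologicalComplex _).obj K).cyclesIsKernel n (n+1) (by simp)) WalkingParallelPair.zero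

lemma homologyMapIso (F : A ⥤ B) [F.Additive] [PreservesFiniteLimits F] (n : ℕ) :
    Nonempty (((F.mapHomologicalComplex _).obj K).homology (n+1) ≅
      cokernel (F.map (K.toCycles n (n+1)))) := by
  refine ⟨(IsColimit.coconePointUniqueUpToIso (cokernelIsCokernel _)
    (((F.mapHomologicalComplex _).obj K).homologyIsCokernel n (n+1) (by simp))).symm ≪≫ 
    (cokernel.mapIso _ _ (Iso.refl _) (cyclesMapIso K F (n+1)) ?_).symm⟩
  change F.map (K.toCycles n (n+1)) ≫ (cyclesMapIso K F (n+1)).hom =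
    𝟙 (((F.mapHomologicalComplex _).obj K).X n) ≫ _
  refine Eq.trans ?_ (Category.id_comp _).symm
  refine (cancel_mono (((F.mapHomologicalComplex _).obj K).iCycles (n+1))).1 ?_
  have e1 : (F.map (K.toCycles n (n+1)) ≫ (cyclesMapIso K F (n+1)).hom) ≫
      ((F.mapHomologicalComplex _).obj K).iCycles (n+1) = F.map (K.d n (n+1)) := by
    refine (Category.assoc _ _ _).trans ?_
    refine (congrArg (fun z => F.map (K.toCycles n (n+1)) ≫ z) (cyclesMapIso_i K F (n+1))).trans ?_
    refine (F.map_comp _ _).symm.trans ?_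
    rw [K.toCycles_i]
  exact e1.trans (((F.mapHomologicalComplex _).obj K).toCycles_i n (n+1)).symm

lemma homologyMapIso₀ (F : A ⥤ B) [F.Additive] [PreservesFiniteLimits F] :
    Nonempty (((F.mapHomologicalComplex _).obj K).homology 0 ≅ F.obj (K.homology 0)) := 
  ⟨(CochainComplex.isoHomologyπ₀ _).symm ≪≫ (cyclesMapIso K F 0).symm ≪≫
    F.mapIso (CochainComplex.isoHomologyπ₀ _)⟩

end Complex

include hT

theorem core [(T 0).Additive] (K : CochainComplex A ℕ)
    (hK : ∀ i p, IsZero ((T (p+1)).obj (K.X i))) (s t : ℕ)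
    (ha : ∀ i p, i + p = s + t → i ≠ t → IsZero ((T p).obj (K.homology i)))
    (hb : ∀ i p, i < t → i + p = s + t + 1 → IsZero ((T p).obj (K.homology i)))
    (hc : ∀ i p, t < i → i + p + 1 = s + t → IsZero ((T p).obj (K.homology i))) :
    Nonempty ((T s).obj (K.homology t) ≅
      (((T 0).mapHomologicalComplex _).obj K).homology (s + t)) := by
  have := hT.preservesFiniteLimits
  -- shifting
  have sh : ∀ i p, Nonempty ((T (p+1)).obj (bd K (i+1)) ≅ (T (p+2)).obj (K.cycles i)) :=
    fun i p => hT.iso_δ (sesZ_exact K i) (hK i p) (hK i (p+1))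
  have shz : ∀ i p, IsZero ((T (p+2)).obj (K.cycles i)) → IsZero ((T (p+1)).obj (bd K (i+1))) :=
    fun i p h => h.of_iso (sh i p).some
  -- step 1
  have z1 : ∀ i p, i < t → i + p = s + t → IsZero ((T p).obj (K.cycles i)) := by
    intro i
    induction i with
    | zero =>
      intro p h1 h2
      exact hT.isZero₂ (sesH_exact K 0) (hT.isZero_of_isZero (isZero_bd_zero K) _)
        (ha _ _ h2 (by omega))
    | succ i ih =>
      intro p h1 h2
      obtain ⟨p, rfl⟩ : ∃ q, p = q + 1 := ⟨p - 1, by omega⟩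
      exact hT.isZero₂ (sesH_exact K (i+1)) (shz _ _ (ih (p+2) (by omega) (by omega)))
        (ha _ _ h2 (by omega))
  have z2 : ∀ i p, i < t → i + p = s + t + 1 → IsZero ((T p).obj (K.cycles i)) := by
    intro i
    induction i with
    | zero =>
      intro p h1 h2
      exact hT.isZero₂ (sesH_exact K 0) (hT.isZero_of_isZero (isZero_bd_zero K) _)
        (hb _ _ h1 h2)
    | succ i ih =>
      intro p h1 h2
      obtain ⟨p, rfl⟩ : ∃ q, p = q + 1 := ⟨p - 1, by omega⟩
      exact hT.isZero₂ (sesH_exact K (i+1)) (shz _ _ (ih (p+2) (by omega) (by omega)))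
        (hb _ _ h1 h2)
  rcases Nat.eq_zero_or_pos s with rfl | hs
  · rw [zero_add]
    cases t with
    | zero => exact ⟨(homologyMapIso₀ K (T 0)).some.symm⟩
    | succ t =>
      have e1 : Epi ((T 0).map (toBd K t)) :=
        hT.epi_g (sesZ_exact K t) (z1 t 1 (by omega) (by omega))
      have e2 : Epi ((T 0).map (K.homologyπ (t+1))) :=
        hT.epi_g (sesH_exact K (t+1)) (shz _ _ (z2 t 2 (by omega) (by omega)))
      obtain ⟨w, h⟩ := hT.ex₂ _ (sesH_exact K (t+1)) 0
      have e2' : Epi ((T 0).map (sesH K (t+1)).g) := e2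
      have i1 : cokernel ((T 0).map (kernel.ι (K.homologyπ (t+1)))) ≅ (T 0).obj (K.homology (t+1)) :=
        IsColimit.coconePointUniqueUpToIso (cokernelIsCokernel _) h.gIsCokernel
      have i2 : cokernel ((T 0).map (K.toCycles t (t+1))) ≅
          cokernel ((T 0).map (kernel.ι (K.homologyπ (t+1)))) := by
        refine cokernelIsoOfEq ?_ ≪≫ cokernelEpiComp ((T 0).map (toBd K t)) _
        rw [← (T 0).map_comp, toBd_ι]
      exact ⟨((homologyMapIso K (T 0) t).some ≪≫ i2 ≪≫ i1).symm⟩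
  · -- step 2
    have s2 : Nonempty ((T s).obj (K.cycles t) ≅ (T s).obj (K.homology t)) := by
      refine hT.iso_g (sesH_exact K t) ?_ ?_
      · cases t with
        | zero => exact hT.isZero_of_isZero (isZero_bd_zero K) _
        | succ t =>
          obtain ⟨s, rfl⟩ : ∃ q, s = q + 1 := ⟨s - 1, by omega⟩
          exact shz _ _ (z1 _ _ (by omega) (by omega))
      · cases t with
        | zero => exact hT.isZero_of_isZero (isZero_bd_zero K) _
        | succ t =>
          exact shz _ _ (z2 _ _ (by omega) (by omega))
    -- step 3
    have s3 : ∀ k p, p + 1 + k = s →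
        Nonempty ((T (p+1)).obj (K.cycles (t+k)) ≅ (T s).obj (K.homology t)) := by
      intro k
      induction k with
      | zero =>
        intro p h
        obtain rfl : p + 1 = s := by omega
        exact s2
      | succ k ih =>
        intro p h
        have a1 := (ih (p+1) (by omega)).some
        have a2 := (sh (t+k) p).some
        have a3 := (hT.iso_f (sesH_exact K (t+k+1)) (p := p)
          (hc _ _ (by omega) (by omega)) (ha _ _ (by omega) (by omega))).some
        exact ⟨a3.symm ≪≫ a2 ≪≫ a1⟩
    obtain ⟨k, rfl⟩ : ∃ k, s = k + 1 := ⟨s - 1, by omega⟩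
    have hk : k + 1 + t = t + k + 1 := by omega
    rw [hk]
    have a1 := (s3 k 0 (by omega)).some
    have a2 := (hT.iso_coker (sesZ_exact K (t+k)) (hK _ _)).some
    have z : IsZero ((T 0).obj (K.homology (t+k+1))) := ha _ _ (by omega) (by omega)
    have e1 : Epi ((T 0).map (kernel.ι (K.homologyπ (t+k+1)))) := hT.epi_f (sesH_exact K (t+k+1)) z
    have e2 := isIso_of_mono_of_epi ((T 0).map (kernel.ι (K.homologyπ (t+k+1))))
    have i2 : cokernel ((T 0).map (K.toCycles (t+k) (t+k+1))) ≅
        cokernel ((T 0).map (toBd K (t+k))) := by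
      refine cokernelIsoOfEq ?_ ≪≫ cokernelCompIsIso _ ((T 0).map (kernel.ι (K.homologyπ (t+k+1))))
      rw [← (T 0).map_comp, toBd_ι]
    exact ⟨((homologyMapIso K (T 0) (t+k)).some ≪≫ i2 ≪≫ a2 ≪≫ a1).symm⟩

end Core
end LC

open CategoryTheory Limits

namespace LC

lemma paste {D : Type*} [Category D] {A₁ A₂ B₁ B₂ E₁ E₂ G₁ G₂ : D} {a : A₁ ⟶ A₂} {iX : A₁ ⟶ B₁}
    {iY : A₂ ⟶ B₂} {m : B₁ ⟶ B₂} {dX : B₁ ⟶ E₁} {dY : B₂ ⟶ E₂} {m' : E₁ ⟶ E₂} {jX : E₁ ⟶ G₁}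
    {jY : E₂ ⟶ G₂} {b : G₁ ⟶ G₂} (e1 : a ≫ iY = iX ≫ m) (e3 : dX ≫ m' = m ≫ dY)
    (e2 : jX ≫ b = m' ≫ jY) : a ≫ iY ≫ dY ≫ jY = (iX ≫ dX ≫ jX) ≫ b := by
  simp only [Category.assoc]
  rw [e2, reassoc_of% e1, reassoc_of% e3]

lemma exact_conj {D : Type*} [Category D] [Abelian D] {A₁ A₂ A₃ B₁ B₂ B₃ : D} {f : A₁ ⟶ A₂}
    {g : A₂ ⟶ A₃} {w : f ≫ g = 0} (h : (ShortComplex.mk f g w).Exact)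
    (e₁ : B₁ ≅ A₁) (e₂ : B₂ ≅ A₂) (e₃ : B₃ ≅ A₃) {f' : B₁ ⟶ B₂} {g' : B₂ ⟶ B₃}
    (hf : f' = e₁.hom ≫ f ≫ e₂.inv) (hg : g' = e₂.hom ≫ g ≫ e₃.inv) :
    ∃ w', (ShortComplex.mk f' g' w').Exact := by
  subst hf hg
  refine ⟨by simp [reassoc_of% w], ?_⟩
  refine (ShortComplex.exact_iff_of_iso (ShortComplex.isoMk e₁ e₂ e₃ ?_ ?_)).2 h <;> simp

section LD

universe v₁ u₁ v₂ u₂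
variable {C : Type u₁} [Category.{v₁} C] [Abelian C] [HasProjectiveResolutions C]
  {D : Type u₂} [Category.{v₂} D] [Abelian D]
  {F₁ F₂ F₃ : C ⥤ D} [F₁.Additive] [F₂.Additive] [F₃.Additive] (α : F₁ ⟶ F₂) (β : F₂ ⟶ F₃)
  (w : α ≫ β = 0)

/-- The short complex of chain complexes obtained from a short complex of functors. -/
noncomputable abbrev scF (K : ChainComplex C ℕ) : ShortComplex (ChainComplex D ℕ) :=
  ShortComplex.mk ((NatTrans.mapHomologicalComplex α _).app K)
    ((NatTrans.mapHomologicalComplex β _).app K) (by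
      ext n
      exact NatTrans.congr_app w (K.X n))

variable (h : ∀ (X : C) [Projective X],
  (ShortComplex.mk (α.app X) (β.app X) (NatTrans.congr_app w X)).ShortExact)

include h in
lemma scF_shortExact {X : C} (P : ProjectiveResolution X) :
    (scF α β w P.complex).ShortExact := by
  apply HomologicalComplex.shortExact_of_degreewise_shortExact
  intro i
  exact h (P.complex.X i)

/-- functoriality of `scF`. -/
noncomputable abbrev scFMap {K L : ChainComplex C ℕ} (φ : K ⟶ L) : scF α β w K ⟶ scF α β w L where
  τ₁ := (F₁.mapHomologicalComplex _).map φ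
  τ₂ := (F₂.mapHomologicalComplex _).map φ
  τ₃ := (F₃.mapHomologicalComplex _).map φ
  comm₁₂ := by simp
  comm₂₃ := by simp

/-- The connecting natural transformation. -/
noncomputable def deltaNat (n : ℕ) : F₃.leftDerived (n+1) ⟶ F₁.leftDerived n where
  app X := ((projectiveResolution X).isoLeftDerivedObj F₃ (n+1)).hom ≫
    (scF_shortExact α β w h (projectiveResolution X)).δ (n+1) n (by simp) ≫
    ((projectiveResolution X).isoLeftDerivedObj F₁ n).inv
  naturality {X Y} f := by
    have comm : (ProjectiveResolution.lift f (projectiveResolution X) (projectiveResolution Y)).f 0 ≫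
      (projectiveResolution Y).π.f 0 = (projectiveResolution X).π.f 0 ≫ f :=
      ProjectiveResolution.lift_commutes_zero _ _ _
    have e1 := ProjectiveResolution.isoLeftDerivedObj_hom_naturality f _ _ _ comm F₃ (n+1)
    have e2 := ProjectiveResolution.isoLeftDerivedObj_inv_naturality f _ _ _ comm F₁ n
    have e3 := HomologicalComplex.HomologySequence.δ_naturality
      (scFMap α β w (ProjectiveResolution.lift f (projectiveResolution X) (projectiveResolution Y)))
      (scF_shortExact α β w h _) (scF_shortExact α β w h _) (n+1) n (by simp)
    exact paste e1 e3 e2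

include h in
lemma leftDerived_exact₂ (X : C) (n : ℕ) :
    ∃ w', (ShortComplex.mk ((NatTrans.leftDerived α n).app X) ((NatTrans.leftDerived β n).app X)
      w').Exact :=
  exact_conj ((scF_shortExact α β w h (projectiveResolution X)).homology_exact₂ n) _ _ _
    ((projectiveResolution X).leftDerived_app_eq α n)
    ((projectiveResolution X).leftDerived_app_eq β n)

lemma leftDerived_exact₃ (X : C) (n : ℕ) :
    ∃ w', (ShortComplex.mk ((NatTrans.leftDerived β (n+1)).app X) ((deltaNat α β w h n).app X)
      w').Exact :=
  exact_conj ((scF_shortExact α β w h (projectiveResolution X)).homology_exact₃ (n+1) n (by simp))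
    _ _ _ ((projectiveResolution X).leftDerived_app_eq β (n+1)) rfl

lemma leftDerived_exact₁ (X : C) (n : ℕ) :
    ∃ w', (ShortComplex.mk ((deltaNat α β w h n).app X) ((NatTrans.leftDerived α n).app X)
      w').Exact :=
  exact_conj ((scF_shortExact α β w h (projectiveResolution X)).homology_exact₁ (n+1) n (by simp))
    _ _ _ rfl ((projectiveResolution X).leftDerived_app_eq α n)

include h w in
lemma leftDerived_epi (X : C) : Epi ((NatTrans.leftDerived β 0).app X) := by
  rw [(projectiveResolution X).leftDerived_app_eq β 0]
  have hS := scF_shortExact α β w h (projectiveResolution X)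
  have h1 : Epi ((HomologicalComplex.homologyFunctor D (ComplexShape.down ℕ) 0).map
        ((NatTrans.mapHomologicalComplex β _).app (projectiveResolution X).complex)) := 
    have := hS.epi_g
    HomologicalComplex.epi_homologyMap_of_epi_of_not_rel (scF α β w _).g 0 (by simp)
  infer_instance

end LD
end LC
open CategoryTheory Limits Opposite

namespace LC

lemma exact_of_pointwise {J : Type*} [Category J] {D : Type*} [Category D] [Abelian D]
    (S : ShortComplex (J ⥤ D)) (h : ∀ j, (S.map ((evaluation J D).obj j)).Exact) : S.Exact := by
  rw [ShortComplex.exact_iff_isZero_homology, Functor.isZero_iff]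
  intro j
  have := (ShortComplex.exact_iff_isZero_homology _).1 (h j)
  exact this.of_iso (S.mapHomologyIso ((evaluation J D).obj j)).symm

section Ext
variable {R : Type} [CommRing R]

noncomputable abbrev Y (M : ModuleCat.{0} R) : ModuleCat.{0} R ⥤ (ModuleCat.{0} R)ᵒᵖ :=
  ((linearYoneda R (ModuleCat.{0} R)).obj M).rightOp

noncomputable abbrev YMap {M N : ModuleCat.{0} R} (f : M ⟶ N) : Y N ⟶ Y M :=
  NatTrans.rightOp ((linearYoneda R (ModuleCat.{0} R)).map f)

lemma YMap_comp_zero (S : ShortComplex (ModuleCat.{0} R)) : YMap S.g ≫ YMap S.f = 0 := by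
  ext P
  apply Quiver.Hom.unop_inj
  ext (x : P ⟶ S.X₁)
  change (x ≫ S.f) ≫ S.g = 0
  simp

lemma Y_shortExact {S : ShortComplex (ModuleCat.{0} R)} (hS : S.ShortExact) (P : ModuleCat.{0} R)
    [Projective P] : (ShortComplex.mk ((YMap S.g).app P) ((YMap S.f).app P)
      (NatTrans.congr_app (YMap_comp_zero S) P)).ShortExact := by
  have := hS.mono_f
  have := hS.epi_g
  exact
  { exact := by
      rw [← ShortComplex.exact_unop_iff, ShortComplex.moduleCat_exact_iff]
      intro (x : P ⟶ S.X₂) (hx : x ≫ S.g = 0)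
      exact ⟨hS.exact.lift x hx, hS.exact.lift_f x hx⟩
    mono_f := by
      have : Epi (((linearYoneda R (ModuleCat.{0} R)).map S.g).app (op P)) := by
        rw [ModuleCat.epi_iff_surjective]
        intro (x : P ⟶ S.X₃)
        exact ⟨Projective.factorThru x S.g, Projective.factorThru_comp x S.g⟩
      exact inferInstanceAs (Mono (((linearYoneda R (ModuleCat.{0} R)).map S.g).app (op P)).op)
    epi_g := by
      have : Mono (((linearYoneda R (ModuleCat.{0} R)).map S.f).app (op P)) := by
        rw [ModuleCat.mono_iff_injective]
        intro (x : P ⟶ S.X₁) (y : P ⟶ S.X₁) (h : x ≫ S.f = y ≫ S.f)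
        exact (cancel_mono S.f).1 h
      exact inferInstanceAs (Epi (((linearYoneda R (ModuleCat.{0} R)).map S.f).app (op P)).op) }

lemma Y_map_exact (M : ModuleCat.{0} R) {S : ShortComplex (ModuleCat.{0} R)} (hS : S.ShortExact) :
    (S.map (Y M)).Exact ∧ Epi ((Y M).map S.g) := by
  have := hS.mono_f
  have := hS.epi_g
  constructor
  · rw [← ShortComplex.exact_unop_iff, ShortComplex.moduleCat_exact_iff]
    intro (x : S.X₂ ⟶ M) (hx : S.f ≫ x = 0)
    exact ⟨hS.exact.desc x hx, hS.exact.g_desc x hx⟩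
  · have : Mono (((linearYoneda R (ModuleCat.{0} R)).obj M).map S.g.op) := by
      rw [ModuleCat.mono_iff_injective]
      intro (x : S.X₃ ⟶ M) (y : S.X₃ ⟶ M) (h : S.g ≫ x = S.g ≫ y)
      exact (cancel_epi S.g).1 h
    exact inferInstanceAs (Epi (((linearYoneda R (ModuleCat.{0} R)).obj M).map S.g.op).op)

lemma Y_preserves (M : ModuleCat.{0} R) : PreservesFiniteColimits (Y M) :=
  ((Functor.preservesFiniteColimits_tfae (Y M)).out 0 3).1 fun S hS => Y_map_exact M hS

lemma Y_preservesHomology (M : ModuleCat.{0} R) [Injective M] : (Y M).PreservesHomology := by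
  refine ((Functor.exact_tfae (Y M)).out 0 2).1 fun S hS => ?_
  have := hS.mono_f
  exact
  { exact := (Y_map_exact M hS).1
    epi_g := (Y_map_exact M hS).2
    mono_f := by
      have : Epi (((linearYoneda R (ModuleCat.{0} R)).obj M).map S.f.op) := by
        rw [ModuleCat.epi_iff_surjective]
        intro (x : S.X₁ ⟶ M)
        exact ⟨Injective.factorThru x S.f, Injective.comp_factorThru x S.f⟩
      exact inferInstanceAs (Mono (((linearYoneda R (ModuleCat.{0} R)).obj M).map S.f.op).op) }

lemma Y_leftDerived_isZero (M : ModuleCat.{0} R) [Injective M] (X : ModuleCat.{0} R) (p : ℕ) :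
    IsZero (((Y M).leftDerived (p+1)).obj X) := by
  have := Y_preservesHomology M
  refine IsZero.of_iso ?_ ((projectiveResolution X).isoLeftDerivedObj (Y M) (p+1))
  refine (HomologicalComplex.exactAt_iff_isZero_homology _ _).1 ?_
  exact ((projectiveResolution X).complex_exactAt_succ p).map (Y M)

variable {D : Type} [SmallCategory D] [IsCofiltered D] (I : D ⥤ Ideal R)

/-- Objectwise description of local cohomology -/
noncomputable abbrev TT (p : ℕ) : ModuleCat.{0} R ⥤ ModuleCat.{0} R :=
  (localCohomology.diagram I p).flip ⋙ colim

noncomputable def extDelta {S : ShortComplex (ModuleCat.{0} R)} (hS : S.ShortExact) (p : ℕ) :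
    (localCohomology.diagram I p).flip.obj S.X₃ ⟶
      (localCohomology.diagram I (p+1)).flip.obj S.X₁ :=
  Functor.whiskerLeft (localCohomology.ringModIdeals I).op
    (NatTrans.leftOp (deltaNat _ _ (YMap_comp_zero S) (fun P _ => Y_shortExact hS P) p))

lemma colim_exact {A B C : Dᵒᵖ ⥤ ModuleCat.{0} R} (f : A ⟶ B) (g : B ⟶ C)
    (h : ∀ j, ∃ w, (ShortComplex.mk (f.app j) (g.app j) w).Exact) :
    ∃ w, (ShortComplex.mk (colim.map f) (colim.map g) w).Exact := by
  have w : f ≫ g = 0 := by ext j : 2; exact (h j).choose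
  have e : (ShortComplex.mk f g w).Exact := exact_of_pointwise _ fun j => (h j).choose_spec
  exact ⟨_, e.map colim⟩

lemma unop_ex {A B C : (ModuleCat.{0} R)ᵒᵖ} {f : A ⟶ B} {g : B ⟶ C}
    (h : ∃ w, (ShortComplex.mk f g w).Exact) :
    ∃ w, (ShortComplex.mk g.unop f.unop w).Exact := by
  obtain ⟨w, h⟩ := h
  exact ⟨_, h.unop⟩

lemma TT_delta : DeltaFunctor (TT I) where
  mono₀ S hS := by
    have : Mono ((localCohomology.diagram I 0).flip.map S.f) := by
      have : ∀ j, Mono (((localCohomology.diagram I 0).flip.map S.f).app j) := fun j => by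
        have := leftDerived_epi _ _ (YMap_comp_zero S) (fun P _ => Y_shortExact hS P) 
          ((localCohomology.ringModIdeals I).obj j.unop)
        exact inferInstanceAs (Mono (((NatTrans.leftDerived (YMap S.f) 0).app
          ((localCohomology.ringModIdeals I).obj j.unop)).unop))
      exact NatTrans.mono_of_mono_app _
    exact inferInstanceAs (Mono (colim.map ((localCohomology.diagram I 0).flip.map S.f)))
  ex₂ S hS p := by
    refine colim_exact _ _ fun j => ?_
    exact unop_ex (leftDerived_exact₂ _ _ (YMap_comp_zero S) (fun P _ => Y_shortExact hS P) 
          ((localCohomology.ringModIdeals I).obj j.unop) p)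
  exδ S hS p := by
    obtain ⟨w₁, h₁⟩ := colim_exact ((localCohomology.diagram I p).flip.map S.g) (extDelta I hS p)
      fun j => unop_ex (leftDerived_exact₁ _ _ (YMap_comp_zero S) (fun P _ => Y_shortExact hS P) 
          ((localCohomology.ringModIdeals I).obj j.unop) p)
    obtain ⟨w₂, h₂⟩ := colim_exact (extDelta I hS p)
      ((localCohomology.diagram I (p+1)).flip.map S.f) 
      fun j => unop_ex (leftDerived_exact₃ _ _ (YMap_comp_zero S) (fun P _ => Y_shortExact hS P) 
          ((localCohomology.ringModIdeals I).obj j.unop) p)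
    exact ⟨colim.map (extDelta I hS p), w₁, w₂, h₁, h₂⟩

lemma TT_isZero (p : ℕ) (M : ModuleCat.{0} R) [Injective M] : IsZero ((TT I (p+1)).obj M) := by
  refine colim.map_isZero ?_
  rw [Functor.isZero_iff]
  intro j
  exact (Y_leftDerived_isZero M ((localCohomology.ringModIdeals I).obj j.unop) p).unop

end Ext
end LC
open CategoryTheory Limits Opposite
namespace LC
lemma fromZ'_nat {C D : Type*} [Category C] [Category D] [Abelian C] [Abelian D]
    {F G : C ⥤ D} [F.Additive] [G.Additive] (α : F ⟶ G) {X : C} (P : ProjectiveResolution X) :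
    HomologicalComplex.opcyclesMap ((NatTrans.mapHomologicalComplex α _).app P.complex) 0 ≫
      P.fromLeftDerivedZero' G = P.fromLeftDerivedZero' F ≫ α.app X := by
  rw [← cancel_epi (HomologicalComplex.pOpcycles _ _)]
  refine (HomologicalComplex.p_opcyclesMap_assoc _ _ _).trans ?_
  refine Eq.trans ?_ (P.pOpcycles_comp_fromLeftDerivedZero'_assoc F (α.app X)).symm
  rw [P.pOpcycles_comp_fromLeftDerivedZero' G]
  exact (α.naturality (P.π.f 0)).symm

lemma fromZ_nat {C D : Type*} [Category C] [Category D] [Abelian C] [Abelian D]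
    [HasProjectiveResolutions C]
    {F G : C ⥤ D} [F.Additive] [G.Additive] (α : F ⟶ G) (X : C) :
    (NatTrans.leftDerived α 0).app X ≫ G.fromLeftDerivedZero.app X =
      F.fromLeftDerivedZero.app X ≫ α.app X := by
  let P := projectiveResolution X
  rw [P.leftDerived_app_eq, P.fromLeftDerivedZero_eq F, P.fromLeftDerivedZero_eq G,
    Category.assoc, Category.assoc, Iso.inv_hom_id_assoc]
  refine Eq.trans ?_ (Category.assoc _ _ _).symm
  congr 1
  refine Eq.trans ?_ (Category.assoc _ _ _).symm
  refine Eq.trans ?_ (congrArg (fun u =>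
    (ChainComplex.isoHomologyι₀ ((F.mapHomologicalComplex (ComplexShape.down ℕ)).obj
      P.complex)).hom ≫ u) (fromZ'_nat α P))
  exact HomologicalComplex.homologyι_naturality_assoc _ _ _

section Gam
variable {R : Type} [CommRing R]

def GamS (J : Ideal R) (M : Type) [AddCommGroup M] [Module R M] : Submodule R M where
  carrier := {m | ∃ k, ∀ r ∈ J ^ k, r • m = 0}
  zero_mem' := ⟨0, fun r _ => smul_zero r⟩
  add_mem' := by
    rintro x y ⟨k, hk⟩ ⟨l, hl⟩
    refine ⟨k + l, fun r hr => ?_⟩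
    rw [smul_add, hk r (Ideal.pow_le_pow_right (Nat.le_add_right _ _) hr),
      hl r (Ideal.pow_le_pow_right (Nat.le_add_left _ _) hr), add_zero]
  smul_mem' := by
    rintro c x ⟨k, hk⟩
    refine ⟨k, fun r hr => ?_⟩
    rw [smul_comm, hk r hr, smul_zero]

lemma mem_GamS (J : Ideal R) {M : Type} [AddCommGroup M] [Module R M] (m : M) :
    m ∈ GamS J M ↔ ∃ k, ∀ r ∈ J ^ k, r • m = 0 := Iff.rfl

lemma GamS_map (J : Ideal R) {M N : Type} [AddCommGroup M] [Module R M] [AddCommGroup N]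
    [Module R N] (f : M →ₗ[R] N) (m : M) (h : m ∈ GamS J M) : f m ∈ GamS J N := by
  obtain ⟨k, hk⟩ := h
  exact ⟨k, fun r hr => by rw [← f.map_smul, hk r hr, f.map_zero]⟩

def Gam (J : Ideal R) : ModuleCat.{0} R ⥤ ModuleCat.{0} R where
  obj M := ModuleCat.of R (GamS J M)
  map {M N} f := ModuleCat.ofHom (f.hom.restrict (GamS_map J f.hom))

instance (J : Ideal R) : (Gam J).Additive where
  map_add := by intros; rfl

def GamComp (a b : Ideal R) : Gam b ⋙ Gam a ≅ Gam (a + b) :=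
  NatIso.ofComponents (fun M => LinearEquiv.toModuleIso
    { toFun := fun x => ⟨x.1.1, by
        obtain ⟨⟨x, ⟨l, hl⟩⟩, k, hk⟩ := x
        refine ⟨k + l, fun r hr => ?_⟩
        obtain ⟨u, hu, v, hv, rfl⟩ := Submodule.mem_sup.1 (Ideal.sup_pow_add_le_pow_sup_pow hr)
        have := congrArg Subtype.val (hk u hu)
        change u • x = 0 at this
        change (u + v) • x = 0
        rw [add_smul, this, hl v hv, add_zero]⟩
      map_add' := fun _ _ => rfl
      map_smul' := fun _ _ => rfl
      invFun := fun x => ⟨⟨x.1, by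
        obtain ⟨x, k, hk⟩ := x
        exact ⟨k, fun r hr => hk r (Ideal.pow_right_mono le_sup_right k hr)⟩⟩, by
        obtain ⟨x, k, hk⟩ := x
        exact ⟨k, fun r hr => Subtype.ext (hk r (Ideal.pow_right_mono le_sup_left k hr))⟩⟩
      left_inv := fun _ => rfl
      right_inv := fun _ => rfl })
    (fun f => rfl)

lemma Gam_injective [IsNoetherianRing R] (J : Ideal R) (E : ModuleCat.{0} R) [Injective E] :
    Injective ((Gam J).obj E) := by
  have hE : Module.Injective R E := (Module.injective_iff_injective_object R E).2 (by assumption)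
  suffices Module.Injective R (GamS J E) from 
    (Module.injective_iff_injective_object R (GamS J E)).1 this
  apply Module.Baer.injective
  intro L f
  obtain ⟨k, hk⟩ : ∃ k, ∀ r ∈ J ^ k, ∀ x, r • f x = 0 := by
    obtain ⟨S, hS⟩ : (⊤ : Submodule R L).FG := IsNoetherian.noetherian _
    classical
    have : ∀ S : Finset L, ∃ k, ∀ r ∈ J ^ k, ∀ x ∈ Submodule.span R (S : Set L), r • f x = 0 := by
      intro S
      induction S using Finset.induction_on with
      | empty => 
        refine ⟨0, fun r _ x hx => ?_⟩
        simp at hx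
        simp [hx]
      | insert y S _ ih =>
        obtain ⟨k, hk⟩ := ih
        obtain ⟨l, hl⟩ := (f y).2
        refine ⟨k + l, fun r hr x hx => ?_⟩
        rw [Finset.coe_insert, Submodule.mem_span_insert] at hx
        obtain ⟨c, z, hz, rfl⟩ := hx
        have h1 : r • f y = 0 :=
          Subtype.ext (hl r (Ideal.pow_le_pow_right (Nat.le_add_left _ _) hr))
        rw [map_add, map_smul, smul_add, 
          hk r (Ideal.pow_le_pow_right (Nat.le_add_right _ _) hr) z hz, smul_comm, h1]
        simp
    obtain ⟨k, hk⟩ := this S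
    exact ⟨k, fun r hr x => hk r hr x (by rw [hS]; trivial)⟩
  obtain ⟨c, hc⟩ := Ideal.exists_pow_inf_eq_pow_smul J (M := R) L
  have hAR : ∀ x (hx : x ∈ L), x ∈ J ^ (k + c) → f ⟨x, hx⟩ = 0 := by
    intro x hx hxJ
    have h := hc (k + c) (Nat.le_add_left _ _)
    have h1 : x ∈ (J ^ (k + c) • (⊤ : Submodule R R) ⊓ L) := ⟨by simpa using hxJ, hx⟩
    rw [h, Nat.add_sub_cancel] at h1
    have h2 : x ∈ J ^ k • L := Submodule.smul_mono le_rfl inf_le_right h1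
    have h3 : ∀ y ∈ J ^ k • L, ∃ hy : y ∈ L, f ⟨y, hy⟩ = 0 := by
      intro y hy
      refine Submodule.smul_induction_on hy (fun r hr n hn => ?_) ?_
      · refine ⟨L.smul_mem r hn, ?_⟩
        have := hk r hr ⟨n, hn⟩
        rw [← map_smul] at this
        exact this
      · rintro y z ⟨hy, hy'⟩ ⟨hz, hz'⟩
        refine ⟨L.add_mem hy hz, ?_⟩
        have := f.map_add ⟨y, hy⟩ ⟨z, hz⟩
        rw [hy', hz', add_zero] at this
        exact this
    exact (h3 x h2).2
  -- extension to `R`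
  obtain ⟨g, hg⟩ : ∃ g : R →ₗ[R] E, (∀ x (hx : x ∈ L), g x = (f ⟨x, hx⟩ : E)) ∧
      ∀ x ∈ J ^ (k + c), g x = 0 := by
    let q : L →ₗ[R] R ⧸ (J ^ (k + c)) := (Submodule.mkQ (J ^ (k + c))).comp L.subtype
    have hq : LinearMap.ker q ≤ LinearMap.ker f := by
      rintro ⟨x, hx⟩ h
      have : x ∈ J ^ (k + c) := (Submodule.Quotient.mk_eq_zero _).1 h
      exact hAR x hx this
    let i : (L ⧸ LinearMap.ker q) →ₗ[R] R ⧸ (J ^ (k + c)) := (LinearMap.ker q).liftQ q le_rfl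
    have hi : Function.Injective i := by
      rw [← LinearMap.ker_eq_bot, Submodule.ker_liftQ_eq_bot _ _ _ le_rfl]
    let f' : (L ⧸ LinearMap.ker q) →ₗ[R] E := 
      (GamS J E).subtype.comp ((LinearMap.ker q).liftQ f hq)
    obtain ⟨h, hh⟩ := Module.Injective.out i hi f'
    refine ⟨h.comp (Submodule.mkQ _), fun x hx => hh (Submodule.Quotient.mk ⟨x, hx⟩), 
      fun x hx => ?_⟩
    have : (Submodule.mkQ (J ^ (k + c))) x = 0 :=
      (Submodule.Quotient.mk_eq_zero _).2 hx
    rw [LinearMap.comp_apply, this, map_zero]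
  have h1 : g 1 ∈ GamS J E := ⟨k + c, fun r hr => by 
    rw [← map_smul, smul_eq_mul, mul_one]; exact hg.2 r hr⟩
  refine ⟨LinearMap.toSpanSingleton R _ ⟨g 1, h1⟩, fun x hx => ?_⟩
  apply Subtype.ext
  rw [← hg.1 x hx]
  change x • g 1 = g x
  rw [← map_smul, smul_eq_mul, mul_one]
end Gam
end LC
open CategoryTheory Limits Opposite
namespace LC
section TTG
variable {R : Type} [CommRing R]
variable {D : Type} [SmallCategory D] (I : D ⥤ Ideal R)

noncomputable abbrev HomD : Dᵒᵖ ⥤ ModuleCat.{0} R ⥤ ModuleCat.{0} R :=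
  (localCohomology.ringModIdeals I).op ⋙ (linearYoneda R (ModuleCat.{0} R)).flip

noncomputable def toExt0 (M : ModuleCat.{0} R) :
    (HomD I).flip.obj M ⟶ (localCohomology.diagram I 0).flip.obj M :=
  Functor.whiskerLeft (localCohomology.ringModIdeals I).op
    (NatTrans.leftOp (Y M).fromLeftDerivedZero)

instance (M : ModuleCat.{0} R) : IsIso (toExt0 I M) := by
  have := Y_preserves M
  have : ∀ j, IsIso ((toExt0 I M).app j) := fun j =>
    inferInstanceAs (IsIso ((Y M).fromLeftDerivedZero.app
      ((localCohomology.ringModIdeals I).obj j.unop)).unop)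
  exact NatIso.isIso_of_isIso_app _

noncomputable def toExt0Nat : (HomD I).flip ⟶ (localCohomology.diagram I 0).flip where
  app M := toExt0 I M
  naturality M N f := by
    ext j : 2
    exact congrArg Quiver.Hom.unop
      (fromZ_nat (YMap f) ((localCohomology.ringModIdeals I).obj j.unop)).symm

instance : IsIso (toExt0Nat I) := by
  have : ∀ M, IsIso ((toExt0Nat I).app M) := fun M => inferInstanceAs (IsIso (toExt0 I M))
  exact NatIso.isIso_of_isIso_app _

noncomputable def TT0Iso : TT I 0 ≅ (HomD I).flip ⋙ colim :=
  (Functor.isoWhiskerRight (asIso (toExt0Nat I)) colim).symm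

variable (J : Ideal R)

noncomputable def gamCocone (M : ModuleCat.{0} R) :
    Cocone ((HomD (localCohomology.idealPowersDiagram J)).flip.obj M) where
  pt := (Gam J).obj M
  ι := 
  { app := fun j => ModuleCat.ofHom (Y := GamS J M)
      (X := (ModuleCat.of R (R ⧸ J ^ j.unop.unop) ⟶ M))
      { toFun := fun φ => ⟨φ.hom (Submodule.Quotient.mk 1), j.unop.unop, fun r hr => by
          rw [← map_smul, ← Submodule.Quotient.mk_smul, smul_eq_mul, mul_one,
            (Submodule.Quotient.mk_eq_zero _).2 hr, map_zero]⟩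
        map_add' := fun _ _ => rfl
        map_smul' := fun _ _ => rfl }
    naturality := fun i j f => rfl }

lemma gamCocone_bij (M : ModuleCat.{0} R) :
    Function.Bijective (colimit.desc _ (gamCocone J M)).hom := by
  have hι : ∀ j x, (colimit.desc _ (gamCocone J M)).hom ((colimit.ι
      ((HomD (localCohomology.idealPowersDiagram J)).flip.obj M) j).hom x) = 
      ((gamCocone J M).ι.app j).hom x := fun j x => 
    LinearMap.congr_fun (congrArg ModuleCat.Hom.hom (colimit.ι_desc (gamCocone J M) j)) x
  constructor
  · refine (injective_iff_map_eq_zero _).2 fun x hx => ?_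
    obtain ⟨j, (y : ModuleCat.of R (R ⧸ J ^ j.unop.unop) ⟶ M), rfl⟩ := Concrete.colimit_exists_rep _ x
    have h2 := (hι j y).symm.trans hx
    have h1 : y.hom (Submodule.Quotient.mk 1) = 0 := congrArg Subtype.val h2
    have : y = 0 := by
      refine ModuleCat.hom_ext (LinearMap.ext fun z => ?_)
      obtain ⟨r, rfl⟩ := Submodule.Quotient.mk_surjective _ z
      have : (Submodule.Quotient.mk r : R ⧸ J ^ j.unop.unop) = r • Submodule.Quotient.mk 1 := by
        rw [← Submodule.Quotient.mk_smul, smul_eq_mul, mul_one]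
      rw [this, map_smul, h1]
      simp
    subst this
    exact map_zero _
  · rintro ⟨m, k, hk⟩
    let φ : ModuleCat.of R (R ⧸ J ^ k) ⟶ M := ModuleCat.ofHom
      ((J ^ k).liftQ (LinearMap.toSpanSingleton R M m) (fun r hr => hk r hr))
    refine ⟨(colimit.ι ((HomD (localCohomology.idealPowersDiagram J)).flip.obj M) 
      (op (op k))).hom φ, ?_⟩
    refine (hι (op (op k)) φ).trans (Subtype.ext ?_)
    change (1 : R) • m = m
    exact one_smul _ _

noncomputable def toGam : 
    (HomD (localCohomology.idealPowersDiagram J)).flip ⋙ colim ⟶ Gam J where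
  app M := colimit.desc _ (gamCocone J M)
  naturality M N f := by
    apply colimit.hom_ext
    intro j
    refine (colimit.ι_map_assoc _ j _).trans ?_
    refine (congrArg (fun u => _ ≫ u) (colimit.ι_desc (gamCocone J N) j)).trans ?_
    exact (colimit.ι_desc_assoc (gamCocone J M) j ((Gam J).map f)).symm

instance : IsIso (toGam J) := by
  have : ∀ M, IsIso ((toGam J).app M) := fun M => by
    rw [ConcreteCategory.isIso_iff_bijective]
    exact gamCocone_bij J M
  exact NatIso.isIso_of_isIso_app _

abbrev IP := localCohomology.idealPowersDiagram J

noncomputable def TTGam : TT (IP J) 0 ≅ Gam J := TT0Iso _ ≪≫ asIso (toGam J)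

instance : (TT (IP J) 0).Additive := Functor.additive_of_iso (TTGam J).symm

noncomputable def LCTT (p : ℕ) : localCohomology J p ≅ TT (IP J) p :=
  colimitIsoFlipCompColim (localCohomology.diagram (IP J) p)

end TTG
end LC

open CategoryTheory Limits Opposite
namespace LC
section Fin
variable {R : Type} [CommRing R]

lemma TT_resolution (J : Ideal R) (X : ModuleCat.{0} R) (E : InjectiveResolution X) (n : ℕ) :
    Nonempty ((TT (IP J) n).obj X ≅
      (((TT (IP J) 0).mapHomologicalComplex _).obj E.cocomplex).homology n) := by
  have hz : ∀ i, 0 < i → IsZero (E.cocomplex.homology i) := fun i hi => by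
    obtain ⟨i, rfl⟩ := Nat.exists_eq_add_of_lt hi
    rw [← HomologicalComplex.exactAt_iff_isZero_homology]
    rw [zero_add]
    exact E.cocomplex_exactAt_succ i
  have := TT_delta (IP J)
  obtain ⟨e⟩ := core this E.cocomplex (fun i p => TT_isZero (IP J) p (E.cocomplex.X i)) n 0
    (fun i p _ hi => this.isZero_of_isZero (hz i (Nat.pos_of_ne_zero hi)) p)
    (fun i p hi => absurd hi (Nat.not_lt_zero _))
    (fun i p hi _ => this.isZero_of_isZero (hz i hi) p)
  let e0 : X ≅ E.cocomplex.homology 0 := by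
    have := asIso (HomologicalComplex.homologyMap E.ι 0)
    exact (HomologicalComplex.singleObjHomologySelfIso (ComplexShape.up ℕ) 0 X).symm ≪≫ this
  exact ⟨(TT (IP J) n).mapIso e0 ≪≫ e⟩

theorem main [IsNoetherianRing R] (a b : Ideal R) (X : ModuleCat.{0} R) (s t : ℕ)
    (ha : ∀ i p, i + p = s + t → i ≠ t → IsZero ((TT (IP a) p).obj ((TT (IP b) i).obj X)))
    (hb : ∀ i p, i < t → i + p = s + t + 1 → IsZero ((TT (IP a) p).obj ((TT (IP b) i).obj X)))
    (hc : ∀ i p, t < i → i + p + 1 = s + t → IsZero ((TT (IP a) p).obj ((TT (IP b) i).obj X))) :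
    Nonempty ((TT (IP a) s).obj ((TT (IP b) t).obj X) ≅ (TT (IP (a + b)) (s + t)).obj X) := by
  let E := injectiveResolution X
  let K := ((TT (IP b) 0).mapHomologicalComplex (ComplexShape.up ℕ)).obj E.cocomplex
  have eb : ∀ i, Nonempty ((TT (IP b) i).obj X ≅ K.homology i) := TT_resolution b X E
  have hK : ∀ i p, IsZero ((TT (IP a) (p+1)).obj (K.X i)) := fun i p => by
    have h1 : Injective ((Gam b).obj (E.cocomplex.X i)) := Gam_injective b _
    have h2 : Injective (K.X i) := Injective.of_iso ((TTGam b).app (E.cocomplex.X i)).symm h1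
    exact TT_isZero (IP a) p (K.X i)
  have tr : ∀ i p, IsZero ((TT (IP a) p).obj ((TT (IP b) i).obj X)) →
      IsZero ((TT (IP a) p).obj (K.homology i)) := fun i p h =>
    h.of_iso ((TT (IP a) p).mapIso (eb i).some.symm)
  obtain ⟨e⟩ := core (TT_delta (IP a)) K hK s t (fun i p h h' => tr i p (ha i p h h'))
    (fun i p h h' => tr i p (hb i p h h')) (fun i p h h' => tr i p (hc i p h h'))
  let e1 : TT (IP b) 0 ⋙ TT (IP a) 0 ≅ TT (IP (a + b)) 0 :=
    Functor.isoWhiskerRight (TTGam b) _ ≪≫ Functor.isoWhiskerLeft _ (TTGam a) ≪≫ GamComp a b ≪≫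
      (TTGam (a + b)).symm
  let e2 : ((TT (IP a) 0).mapHomologicalComplex (ComplexShape.up ℕ)).obj K ≅ 
      ((TT (IP (a + b)) 0).mapHomologicalComplex (ComplexShape.up ℕ)).obj E.cocomplex :=
    HomologicalComplex.Hom.isoOfComponents (fun i => e1.app (E.cocomplex.X i))
      (fun i j _ => (e1.hom.naturality (E.cocomplex.d i j)).symm)
  exact ⟨(TT (IP a) s).mapIso (eb t).some ≪≫ e ≪≫
    (HomologicalComplex.homologyFunctor _ _ (s + t)).mapIso e2 ≪≫
    (TT_resolution (a + b) X E (s + t)).some.symm⟩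

noncomputable def LCTT₂ (a b : Ideal R) (X : ModuleCat.{0} R) (p i : ℕ) :
    (localCohomology a p).obj ((localCohomology b i).obj X) ≅
      (TT (IP a) p).obj ((TT (IP b) i).obj X) :=
  (LCTT a p).app _ ≪≫ (TT (IP a) p).mapIso ((LCTT b i).app X)

lemma transfer (a b : Ideal R) (X : ModuleCat.{0} R) (p q i : ℕ) (h : p = q)
    (hs : Subsingleton ((localCohomology a p).obj ((localCohomology b i).obj X))) :
    IsZero ((TT (IP a) q).obj ((TT (IP b) i).obj X)) := by
  subst h
  exact (ModuleCat.isZero_of_subsingleton _).of_iso (LCTT₂ a b X p i).symm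

end Fin
end LC

end

open CategoryTheory

/-- Let `R` be a commutative noetherian ring, `a, b` ideals of `R`, `X` an
`R`-module and `s, t ≥ 0` such that
(a) `H^{s+t-i}_a(H^i_b(X)) = 0` for all `i ∈ {0, ..., s+t}` with `i ≠ t`;
(b) `H^{s+t-i+1}_a(H^i_b(X)) = 0` for all `i ∈ {0, ..., t-1}`;
(c) `H^{s+t-i-1}_a(H^i_b(X)) = 0` for all `i ∈ {t+1, ..., s+t}`.
Then `H^s_a(H^t_b(X)) ≅ H^{s+t}_{a+b}(X)`. -/
theorem statement6 {R : Type} [CommRing R] [IsNoetherianRing R] (a b : Ideal R)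
    (X : ModuleCat R) (s t : ℕ)
    (ha : ∀ i, i ≤ s + t → i ≠ t →
      Subsingleton ((localCohomology a (s + t - i)).obj ((localCohomology b i).obj X)))
    (hb : ∀ i, i < t →
      Subsingleton ((localCohomology a (s + t - i + 1)).obj ((localCohomology b i).obj X)))
    (hc : ∀ i, t + 1 ≤ i → i ≤ s + t →
      Subsingleton ((localCohomology a (s + t - i - 1)).obj ((localCohomology b i).obj X))) :
    Nonempty ((localCohomology a s).obj ((localCohomology b t).obj X) ≅
      (localCohomology (a + b) (s + t)).obj X) := by
  obtain ⟨e⟩ := LC.main a b X s t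
    (fun i p h h' => LC.transfer a b X _ _ i (by omega) (ha i (by omega) h'))
    (fun i p h h' => LC.transfer a b X _ _ i (by omega) (hb i h))
    (fun i p h h' => LC.transfer a b X _ _ i (by omega) (hc i h (by omega)))
  exact ⟨LC.LCTT₂ a b X s t ≪≫ e ≪≫ ((LC.LCTT (a + b) (s + t)).app X).symm⟩
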